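/- arXiv:1804.02116 — 3 statements merged into one kernel-verified Lean document; each statement's English description precedes it below -/
import Mathlib

section
/- (Baer's Lemma over Dedekind domains) Let R be a Dedekind domain and A a finite rank torsion-free R-module. Suppose 0 → C → A → B → 0 is a short exact sequence of R-modules with B torsion-free of rank 1, and suppose A = C + Σ_{f ∈ Hom(B,A)} f(B). Then the sequence splits. -/
/-- If `I` is a module over the multiplier ring `B / B` of `B` and `I * B = B`, then `1 ∈ I`. -/
theorem one_mem_of_mul_eq_self {R K : Type*} [CommRing R] [IsDedekindDomain R]
    [Field K] [Algebra R K] [IsFractionRing R K] {I B : Submodule R K} (hB : B ≠ ⊥)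
    (hIB : I * B = B) (hI : I * (B / B) ≤ I) : (1 : K) ∈ I := by
  let J : Ideal R := I.comap (Algebra.linearMap R K)
  let J' : FractionalIdeal (nonZeroDivisors R) K := J
  have hJI : (J' : Submodule R K) ≤ I := by
    rintro _ ⟨r, hr, rfl⟩
    exact hr
  have one_mem : (1 : K) ∈ B / B := by
    simp [Submodule.mem_div_iff_forall_mul_mem]
  have hIE : I ≤ B / B := by
    rw [Submodule.le_div_iff_mul_le, hIB]
  have hle : I ≤ J' * (B / B) := by
    intro x hx
    let F : FractionalIdeal (nonZeroDivisors R) K :=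
      1 + FractionalIdeal.spanSingleton _ x
    have hF1 : (1 : FractionalIdeal (nonZeroDivisors R) K) ≤ F := le_sup_left
    have hFx : FractionalIdeal.spanSingleton (nonZeroDivisors R) x ≤ F := le_sup_right
    have hF0 : F ≠ 0 := fun h ↦ by simp [h] at hF1
    have hFE : (F : Submodule R K) ≤ B / B := by
      rw [FractionalIdeal.coe_add, FractionalIdeal.coe_one, FractionalIdeal.coe_spanSingleton]
      exact sup_le (Submodule.one_le.2 one_mem) (by simpa using hIE hx)
    have hG : F⁻¹ ≤ 1 := by
      simpa [hF0] using mul_le_mul_right hF1 F⁻¹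
    have hxG : FractionalIdeal.spanSingleton _ x * F⁻¹ ≤ J' := by
      intro y hy
      have hy1 : y ∈ (1 : FractionalIdeal (nonZeroDivisors R) K) := by
        simpa [hF0] using mul_le_mul_left hFx F⁻¹ hy
      obtain ⟨r, rfl⟩ := (FractionalIdeal.mem_one_iff _).1 hy1
      obtain ⟨z, hz, hzr⟩ := FractionalIdeal.mem_singleton_mul.1 hy
      obtain ⟨s, rfl⟩ := (FractionalIdeal.mem_one_iff _).1 (hG hz)
      refine (FractionalIdeal.mem_coeIdeal _).2 ⟨r, ?_, rfl⟩
      change algebraMap R K r ∈ I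
      rw [hzr, mul_comm, ← Algebra.smul_def]
      exact I.smul_mem _ hx
    have hxJ : x ∈ J' * F := by
      refine mul_le_mul_left hxG F ?_
      rw [mul_assoc, inv_mul_cancel₀ hF0, mul_one]
      exact FractionalIdeal.mem_spanSingleton_self _ _
    rw [← FractionalIdeal.mem_coe, FractionalIdeal.coe_mul] at hxJ
    exact mul_le_mul_right hFE _ hxJ
  have hEB : (B / B) * B ≤ B := Submodule.le_div_iff_mul_le.1 le_rfl
  have hJB : J' * B = B := by
    refine le_antisymm ?_ ?_
    · calc (J' : Submodule R K) * B ≤ I * B := mul_le_mul_left hJI _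
        _ = B := hIB
    · calc B = I * B := hIB.symm
        _ ≤ J' * (B / B) * B := mul_le_mul_left hle _
        _ = J' * ((B / B) * B) := mul_assoc _ _ _
        _ ≤ J' * B := mul_le_mul_right hEB _
  have hJ0 : J' ≠ 0 := by
    intro h
    rw [h] at hJB
    exact hB (by simpa using hJB.symm)
  have hinv : ((J'⁻¹ : FractionalIdeal (nonZeroDivisors R) K) : Submodule R K) ≤ B / B := by
    rw [Submodule.le_div_iff_mul_le]
    nth_rw 1 [← hJB]
    rw [← mul_assoc, ← FractionalIdeal.coe_mul, inv_mul_cancel₀ hJ0]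
    simp
  have h1 : (1 : K) ∈ J' * J'⁻¹ := by
    rw [mul_inv_cancel₀ hJ0]
    exact FractionalIdeal.one_mem_one _
  rw [← FractionalIdeal.mem_coe, FractionalIdeal.coe_mul] at h1
  exact hI (mul_le_mul' hJI hinv h1)

/-- A torsion-free module of rank one embeds into the fraction field. -/
theorem exists_injective_fractionRing_of_rank_eq_one {R B : Type*} [CommRing R] [IsDomain R]
    [AddCommGroup B] [Module R B] [Module.IsTorsionFree R B] (h : Module.rank R B = 1) :
    ∃ φ : B →ₗ[R] FractionRing R, Function.Injective φ := by
  have hr : Module.rank (FractionRing R) (LocalizedModule (nonZeroDivisors R) B) = 1 := by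
    rw [IsLocalization.rank_eq (FractionRing R) (nonZeroDivisors R) le_rfl]
    simpa [h] using IsLocalizedModule.lift_rank_eq (nonZeroDivisors R)
      (LocalizedModule.mkLinearMap (nonZeroDivisors R) B) le_rfl
  obtain ⟨e⟩ := nonempty_linearEquiv_of_lift_rank_eq
    (R := FractionRing R) (M := LocalizedModule (nonZeroDivisors R) B) (M' := FractionRing R)
    (by simp [hr])
  refine ⟨(e.restrictScalars R).toLinearMap ∘ₗ
    LocalizedModule.mkLinearMap (nonZeroDivisors R) B, ?_⟩
  refine e.injective.comp ?_
  refine (injective_iff_map_eq_zero _).2 fun b hb ↦ ?_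
  obtain ⟨c, hc⟩ := (IsLocalizedModule.eq_zero_iff (nonZeroDivisors R) _).1 hb
  exact (smul_eq_zero_iff_right (nonZeroDivisors.coe_ne_zero c)).1 hc

/-- A linear map from a submodule of the fraction field to the fraction field is a
multiplication. -/
theorem exists_forall_apply_eq_mul {R K B : Type*} [CommRing R] [IsDomain R]
    [Field K] [Algebra R K] [IsFractionRing R K] [AddCommGroup B] [Module R B]
    {φ : B →ₗ[R] K} (hφ : Function.Injective φ) (h : B →ₗ[R] K) :
    ∃ x : K, ∀ b, h b = x * φ b := by
  by_cases hB : ∀ b : B, b = 0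
  · exact ⟨0, fun b ↦ by simp [hB b]⟩
  push Not at hB
  obtain ⟨c, hc⟩ := hB
  have hc' : φ c ≠ 0 := (map_ne_zero_iff φ hφ).2 hc
  refine ⟨h c / φ c, fun b ↦ ?_⟩
  obtain ⟨p, q, hq, hpq⟩ := IsFractionRing.div_surjective (A := R) (φ b / φ c)
  have hq0 : algebraMap R K q ≠ 0 := IsFractionRing.to_map_ne_zero_of_mem_nonZeroDivisors hq
  have hbc : q • b = p • c := by
    apply hφ
    rw [map_smul, map_smul, Algebra.smul_def, Algebra.smul_def]
    field_simp at hpq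
    linear_combination -hpq
  have hh := congrArg h hbc
  rw [map_smul, map_smul, Algebra.smul_def, Algebra.smul_def] at hh
  rw [div_mul_eq_mul_div, mul_div_assoc, ← hpq]
  field_simp
  linear_combination hh

/-- Baer's Lemma over Dedekind domains.  Let `R` be a Dedekind
domain and `A` a finite rank torsion-free `R`-module.  If `C ≤ A` is a submodule
such that `B := A ⧸ C` is torsion-free of rank `1`, and
`A = C + Σ_{f ∈ Hom(B,A)} f(B)`, then the sequence `0 → C → A → B → 0` splits,
i.e. the projection `A → A ⧸ C` has a linear section. -/
theorem stmt4 (R : Type*) [CommRing R] [IsDomain R] [IsDedekindDomain R]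
    (A : Type*) [AddCommGroup A] [Module R A] [NoZeroSMulDivisors R A]
    (hfin : Module.rank R A < Cardinal.aleph0)
    (C : Submodule R A)
    (htf : NoZeroSMulDivisors R (A ⧸ C))
    (hrk : Module.rank R (A ⧸ C) = 1)
    (hgen : C ⊔ (⨆ f : (A ⧸ C) →ₗ[R] A, LinearMap.range f) = ⊤) :
    ∃ s : (A ⧸ C) →ₗ[R] A, C.mkQ ∘ₗ s = LinearMap.id := by
  obtain ⟨φ, hφ⟩ := exists_injective_fractionRing_of_rank_eq_one hrk
  let I : Submodule R (FractionRing R) :=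
    { carrier := {x | ∃ f : (A ⧸ C) →ₗ[R] A, ∀ b, φ (C.mkQ (f b)) = x * φ b}
      zero_mem' := ⟨0, by simp⟩
      add_mem' := by
        rintro x y ⟨f, hf⟩ ⟨g, hg⟩
        exact ⟨f + g, fun b ↦ by
          rw [LinearMap.add_apply, map_add, map_add, hf, hg, add_mul]⟩
      smul_mem' := by
        rintro r x ⟨f, hf⟩
        exact ⟨r • f, fun b ↦ by
          rw [LinearMap.smul_apply, map_smul, map_smul, hf, smul_mul_assoc]⟩ }
  have hB : LinearMap.range φ ≠ ⊥ := by
    rw [Ne, LinearMap.range_eq_bot]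
    rintro rfl
    have : Subsingleton (A ⧸ C) := ⟨fun a b ↦ hφ rfl⟩
    simp at hrk
  have hIB : I * LinearMap.range φ = LinearMap.range φ := by
    refine le_antisymm (Submodule.mul_le.2 ?_) ?_
    · rintro x ⟨f, hf⟩ _ ⟨b, rfl⟩
      exact ⟨_, hf b⟩
    · have key : C ⊔ (⨆ f : (A ⧸ C) →ₗ[R] A, LinearMap.range f) ≤
          (I * LinearMap.range φ).comap (φ ∘ₗ C.mkQ) := by
        refine sup_le (fun c hc ↦ ?_) (iSup_le fun f ↦ ?_)
        · simp [(Submodule.Quotient.mk_eq_zero C).2 hc]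
        · rintro _ ⟨b, rfl⟩
          obtain ⟨x, hx⟩ := exists_forall_apply_eq_mul hφ (φ ∘ₗ C.mkQ ∘ₗ f)
          change φ (C.mkQ (f b)) ∈ I * LinearMap.range φ
          rw [show φ (C.mkQ (f b)) = x * φ b from hx b]
          exact Submodule.mul_mem_mul ⟨f, hx⟩ ⟨b, rfl⟩
      rintro _ ⟨b, rfl⟩
      obtain ⟨a, rfl⟩ := C.mkQ_surjective b
      exact key (hgen ▸ Submodule.mem_top)
  have hI : I * (LinearMap.range φ / LinearMap.range φ) ≤ I := by
    refine Submodule.mul_le.2 ?_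
    rintro x ⟨f, hf⟩ y hy
    rw [Submodule.mem_div_iff_forall_mul_mem] at hy
    let ψ := LinearEquiv.ofInjective φ hφ
    let g : (A ⧸ C) →ₗ[R] (A ⧸ C) := ψ.symm.toLinearMap ∘ₗ
      (LinearMap.mulLeft R y ∘ₗ φ).codRestrict (LinearMap.range φ) fun b ↦ hy _ ⟨b, rfl⟩
    have hg (b) : φ (g b) = y * φ b := congrArg Subtype.val (ψ.apply_symm_apply _)
    exact ⟨f ∘ₗ g, fun b ↦ by rw [LinearMap.comp_apply, hf, hg, mul_assoc]⟩
  obtain ⟨s, hs⟩ := one_mem_of_mul_eq_self hB hIB hI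
  exact ⟨s, LinearMap.ext fun b ↦ hφ (by simpa using hs b)⟩
end

section
/- Let A be a finite rank torsion-free module over a Dedekind domain R, and suppose A has a rank-1 direct summand B with type(B) = IT(A). Then for every positive integer n, the module A^n is a self-pure-generator. -/
open TensorProduct

/-- The pure submodule of `A` generated by `a`:
`⟨a⟩_* = {x ∈ A : r • x ∈ R a for some nonzero r ∈ R}`. -/
def pureGen (R : Type*) {A : Type*} [CommRing R] [IsDomain R] [AddCommGroup A]
    [Module R A] (a : A) : Submodule R A where
  carrier := {x | ∃ r : R, r ≠ 0 ∧ ∃ s : R, r • x = s • a}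
  zero_mem' := ⟨1, one_ne_zero, 0, by simp⟩
  add_mem' := by
    rintro x y ⟨r, hr, s, hx⟩ ⟨r', hr', s', hy⟩
    refine ⟨r * r', mul_ne_zero hr hr', r' * s + r * s', ?_⟩
    rw [smul_add, add_smul, mul_smul, mul_smul, mul_smul, smul_comm r r' x, hx, hy,
      smul_comm r' s a, smul_comm r s' a, smul_smul, smul_smul, mul_comm s' r]
  smul_mem' := by
    rintro c x ⟨r, hr, s, hx⟩
    exact ⟨r, hr, c * s, by rw [smul_comm, hx, mul_smul]⟩
universe u

/-- A submodule `K ≤ A` is pure iff `A ⧸ K` is torsion-free, i.e.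
`r • x ∈ K` with `r ≠ 0` implies `x ∈ K`. -/
def IsPureSubmodule (R : Type*) {A : Type*} [CommRing R] [AddCommGroup A]
    [Module R A] (K : Submodule R A) : Prop :=
  ∀ (r : R) (x : A), r ≠ 0 → r • x ∈ K → x ∈ K

/-- `K` is `A`-generated: some direct sum of copies of `A` surjects onto `K`. -/
def ModGenerated (R : Type*) {A : Type u} [CommRing R] [AddCommGroup A]
    [Module R A] (K : Submodule R A) : Prop :=
  ∃ (ι : Type u) (f : (ι →₀ A) →ₗ[R] K), Function.Surjective f

/-- `A` is a self-pure-generator: every pure submodule of `A` is `A`-generated. -/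
def SelfPureGenerator (R : Type*) (A : Type u) [CommRing R] [AddCommGroup A]
    [Module R A] : Prop :=
  ∀ K : Submodule R A, IsPureSubmodule R K → ModGenerated R K
/-- Any two elements of a torsion-free module of rank one satisfy a nontrivial relation. -/
theorem exists_smul_eq_smul_of_rank_eq_one {R B : Type*} [CommRing R] [IsDomain R]
    [AddCommGroup B] [Module R B] [Module.IsTorsionFree R B] (hB : Module.rank R B = 1)
    (x : B) {y : B} (hy : y ≠ 0) : ∃ r : R, r ≠ 0 ∧ ∃ s : R, r • x = s • y := by
  by_contra! h
  have hli : LinearIndependent R ![x, y] := by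
    rw [LinearIndependent.pair_iff]
    intro a b hab
    have ha : a = 0 := by
      by_contra ha
      exact h a ha (-b) (by rw [neg_smul]; exact eq_neg_of_add_eq_zero_left hab)
    subst ha
    rw [zero_smul, zero_add] at hab
    exact ⟨rfl, (smul_eq_zero.mp hab).resolve_right hy⟩
  have h2 := hli.cardinal_lift_le_rank
  rw [hB] at h2
  simp only [Cardinal.mk_fin, Cardinal.lift_natCast, Cardinal.lift_one] at h2
  norm_num at h2

/-- Divisibility in the localization of a Dedekind domain at a prime is total. -/
theorem exists_notMem_mul_eq_mul {R : Type*} [CommRing R] [IsDedekindDomain R]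
    (p : Ideal R) [p.IsPrime] (hp : p ≠ ⊥) (r s : R) :
    ∃ t ∉ p, ∃ a : R, t * s = a * r ∨ t * r = a * s := by
  have : IsDiscreteValuationRing (Localization.AtPrime p) :=
    IsLocalization.AtPrime.isDiscreteValuationRing_of_dedekind_domain R hp _
  have key : ∀ r s : R, algebraMap R (Localization.AtPrime p) r ∣
      algebraMap R (Localization.AtPrime p) s → ∃ t ∉ p, ∃ a : R, t * s = a * r := by
    rintro r s ⟨c, hc⟩
    obtain ⟨a, t, rfl⟩ := IsLocalization.exists_mk'_eq p.primeCompl c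
    refine ⟨t, t.2, a, IsLocalization.injective (Localization.AtPrime p)
      p.primeCompl_le_nonZeroDivisors ?_⟩
    rw [map_mul, map_mul, hc, mul_left_comm, IsLocalization.mk'_spec', mul_comm]
  rcases ValuationRing.dvd_total (algebraMap R (Localization.AtPrime p) r)
    (algebraMap R (Localization.AtPrime p) s) with h | h
  · obtain ⟨t, ht, a, h⟩ := key r s h
    exact ⟨t, ht, a, .inl h⟩
  · obtain ⟨t, ht, a, h⟩ := key s r h
    exact ⟨t, ht, a, .inr h⟩

section Cyclic

variable {R B : Type*} [CommRing R] [AddCommGroup B] [Module R B]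

theorem span_singleton_sup_pow_smul_eq_top {b : B} {p : Ideal R}
    (h : Submodule.span R {b} ⊔ p • (⊤ : Submodule R B) = ⊤) (k : ℕ) :
    Submodule.span R {b} ⊔ p ^ k • (⊤ : Submodule R B) = ⊤ := by
  induction k with
  | zero => simp
  | succ k ih =>
    rw [eq_top_iff]
    calc ⊤ = Submodule.span R {b} ⊔ p • (Submodule.span R {b} ⊔ p ^ k • ⊤) := by rw [ih, h]
      _ ≤ Submodule.span R {b} ⊔ p ^ (k + 1) • ⊤ := by
        rw [Submodule.smul_sup, ← sup_assoc, pow_succ', Submodule.mul_smul]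
        exact sup_le_sup_right (sup_le le_rfl Submodule.smul_le_right) _

theorem exists_span_singleton_sup_mul_smul_eq_top {I J : Ideal R} (hIJ : I ⊔ J = ⊤)
    (hI : ∃ b : B, Submodule.span R {b} ⊔ I • (⊤ : Submodule R B) = ⊤)
    (hJ : ∃ b : B, Submodule.span R {b} ⊔ J • (⊤ : Submodule R B) = ⊤) :
    ∃ b : B, Submodule.span R {b} ⊔ (I * J) • (⊤ : Submodule R B) = ⊤ := by
  obtain ⟨b₁, h₁⟩ := hI
  obtain ⟨b₂, h₂⟩ := hJ
  obtain ⟨u, hu, v, hv, huv⟩ := Submodule.mem_sup.mp ((Ideal.eq_top_iff_one _).mp hIJ)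
  refine ⟨u • b₂ + v • b₁, (Submodule.eq_top_iff' (p := _)).mpr fun y => ?_⟩
  obtain ⟨_, hx₁, z₁, hz₁, hy₁⟩ := Submodule.mem_sup.mp (h₁ ▸ Submodule.mem_top (x := y))
  obtain ⟨_, hx₂, z₂, hz₂, hy₂⟩ := Submodule.mem_sup.mp (h₂ ▸ Submodule.mem_top (x := y))
  obtain ⟨r₁, rfl⟩ := Submodule.mem_span_singleton.mp hx₁
  obtain ⟨r₂, rfl⟩ := Submodule.mem_span_singleton.mp hx₂
  have hu' : u = 1 - v := eq_sub_of_add_eq huv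
  have hy : y = (v * r₁ + u * r₂) • (u • b₂ + v • b₁) +
      ((u * v) • ((r₁ - r₂) • b₁ + (r₂ - r₁) • b₂) + (v • z₁ + u • z₂)) := by
    have : y = v • (r₁ • b₁ + z₁) + u • (r₂ • b₂ + z₂) := by
      rw [hy₁, hy₂, ← add_smul, add_comm, huv, one_smul]
    rw [this, hu']
    module
  rw [hy]
  refine Submodule.add_mem_sup
    (Submodule.smul_mem _ _ (Submodule.mem_span_singleton_self _))
    (Submodule.add_mem _ (Submodule.smul_mem_smul (Ideal.mul_mem_mul hu hv) trivial)
      (Submodule.add_mem _ ?_ ?_))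
  · rw [mul_comm, Submodule.mul_smul]
    exact Submodule.smul_mem_smul hv hz₁
  · rw [Submodule.mul_smul]
    exact Submodule.smul_mem_smul hu hz₂

end Cyclic

section RankOne

variable {R B : Type*} [CommRing R] [IsDedekindDomain R]
  [AddCommGroup B] [Module R B]

theorem exists_span_singleton_sup_prime_smul_eq_top [Module.IsTorsionFree R B]
    (hB : Module.rank R B = 1) (p : Ideal R) [p.IsPrime] (hp : p ≠ ⊥) :
    ∃ b : B, Submodule.span R {b} ⊔ p • (⊤ : Submodule R B) = ⊤ := by
  by_cases h : p • (⊤ : Submodule R B) = ⊤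
  · exact ⟨0, by rw [h, sup_top_eq]⟩
  obtain ⟨c, -, hc⟩ := SetLike.exists_of_lt (lt_top_iff_ne_top.mpr h)
  have hc0 : c ≠ 0 := fun h0 => hc (h0 ▸ Submodule.zero_mem _)
  have hmax : p.IsMaximal := Ideal.IsPrime.isMaximal inferInstance hp
  refine ⟨c, (Submodule.eq_top_iff' (p := _)).mpr fun y => ?_⟩
  have key : ∀ t ∉ p, ∀ a : R, t • y = a • c →
      y ∈ Submodule.span R {c} ⊔ p • (⊤ : Submodule R B) := by
    intro t ht a hta
    obtain ⟨u, v, hv, huv⟩ := hmax.exists_inv ht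
    have : y = (u * a) • c + v • y := by
      rw [mul_smul, ← hta, smul_smul, ← add_smul, huv, one_smul]
    rw [this]
    exact Submodule.add_mem_sup (Submodule.smul_mem _ _ (Submodule.mem_span_singleton_self c))
      (Submodule.smul_mem_smul hv trivial)
  obtain ⟨r, hr, s, hrs⟩ := exists_smul_eq_smul_of_rank_eq_one hB y hc0
  obtain ⟨t, ht, a, h | h⟩ := exists_notMem_mul_eq_mul p hp r s
  · refine key t ht a (smul_right_injective B hr ?_)
    change r • t • y = r • a • c
    rw [smul_comm, hrs, smul_smul, h, mul_comm, mul_smul]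
  · by_cases hs : s = 0
    · subst hs
      rw [zero_smul, smul_eq_zero] at hrs
      rw [hrs.resolve_left hr]
      exact Submodule.zero_mem _
    have hta : t • c = a • y := by
      refine smul_right_injective B hs ?_
      change s • t • c = s • a • y
      rw [smul_comm, ← hrs, smul_smul, h, mul_comm, mul_smul]
    refine key a (fun ha => hc ?_) t hta.symm
    obtain ⟨u, v, hv, huv⟩ := hmax.exists_inv ht
    have : c = (u * a) • y + v • c := by
      rw [mul_smul, ← hta, smul_smul, ← add_smul, huv, one_smul]
    rw [this]
    exact Submodule.add_mem _
      (Submodule.smul_mem_smul (p.mul_mem_left u ha) trivial)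
      (Submodule.smul_mem_smul hv trivial)

/-- A rank one torsion-free module over a Dedekind domain is cyclic modulo any nonzero ideal. -/
theorem exists_span_singleton_sup_smul_eq_top [Module.IsTorsionFree R B]
    (hB : Module.rank R B = 1) {I : Ideal R} (hI : I ≠ ⊥) :
    ∃ b : B, Submodule.span R {b} ⊔ I • (⊤ : Submodule R B) = ⊤ := by
  revert hI
  refine UniqueFactorizationMonoid.induction_on_coprime I (fun h => (h rfl).elim) ?_ ?_ ?_
  · rintro J hJ -
    rw [Ideal.isUnit_iff.mp hJ]
    exact ⟨0, by simp⟩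
  · rintro p k hp -
    have := Ideal.isPrime_of_prime hp
    obtain ⟨b, hb⟩ := exists_span_singleton_sup_prime_smul_eq_top hB p hp.ne_zero
    exact ⟨b, span_singleton_sup_pow_smul_eq_top hb k⟩
  · intro J L hJL hJ hL hne
    refine exists_span_singleton_sup_mul_smul_eq_top ?_ (hJ (left_ne_zero_of_mul hne))
      (hL (right_ne_zero_of_mul hne))
    exact Ideal.isUnit_iff.mp (hJL (Ideal.dvd_iff_le.mpr le_sup_left)
      (Ideal.dvd_iff_le.mpr le_sup_right))

/-- If `B` has rank one and some multiple of `x` is hit by a map from `B`, then `x` itself is a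
sum of two elements hit by maps from `B`. -/
theorem exists_linearMap_add_eq [Module.IsTorsionFree R B] (hB : Module.rank R B = 1)
    {X : Type*} [AddCommGroup X] [Module R X] [Module.IsTorsionFree R X]
    (f : B →ₗ[R] X) {x : X} {s : R} (hs : s ≠ 0) (hx : s • x ∈ LinearMap.range f) :
    ∃ (h : B →ₗ[R] X) (b₁ b₂ : B), f b₁ + h b₂ = x := by
  obtain ⟨b₀, hb₀⟩ := hx
  obtain ⟨b, hb⟩ := exists_span_singleton_sup_smul_eq_top hB
    (I := Ideal.span {s}) (by simpa using hs)
  have decomp : ∀ y : B, ∃ (c : R) (y' : B), c • b + s • y' = y := by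
    intro y
    obtain ⟨_, h₁, z, hz, hy⟩ := Submodule.mem_sup.mp (hb ▸ Submodule.mem_top (x := y))
    obtain ⟨c, rfl⟩ := Submodule.mem_span_singleton.mp h₁
    rw [Submodule.ideal_span_singleton_smul] at hz
    obtain ⟨y', -, rfl⟩ := (Submodule.mem_smul_pointwise_iff_exists _ _ _).mp hz
    exact ⟨c, y', hy⟩
  obtain ⟨r, b', hb'⟩ := decomp b₀
  have hrb : r • f b = s • (x - f b') := by
    rw [smul_sub, ← hb₀, ← hb', map_add, map_smul, map_smul, add_sub_cancel_right]
  have hinj : Function.Injective (LinearMap.lsmul R X s) := smul_right_injective X hs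
  let e := LinearEquiv.ofInjective _ hinj
  have hr : ∀ y, (r • f) y ∈ LinearMap.range (LinearMap.lsmul R X s) := by
    intro y
    obtain ⟨c, y', rfl⟩ := decomp y
    refine ⟨c • (x - f b') + r • f y', ?_⟩
    rw [LinearMap.lsmul_apply, smul_add, smul_comm s c, ← hrb, LinearMap.smul_apply, map_add,
      map_smul, map_smul, smul_add, smul_comm r c, smul_comm r s]
  refine ⟨e.symm.toLinearMap ∘ₗ (r • f).codRestrict _ hr, b', b, ?_⟩
  have : e.symm ((r • f).codRestrict _ hr b) = x - f b' := by
    rw [LinearEquiv.symm_apply_eq]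
    exact Subtype.ext hrb
  simp [this]

end RankOne

/-- If `b` is sent to a nonzero multiple of every coordinate of `x`, with varying maps and
multiples, then it is sent to a nonzero multiple of `x`. -/
theorem exists_linearMap_pi_apply_eq_smul {R B ι : Type*} {A : ι → Type*} [Fintype ι]
    [CommRing R] [IsDomain R] [AddCommGroup B] [Module R B] [∀ i, AddCommGroup (A i)]
    [∀ i, Module R (A i)] {b : B} {x : ∀ i, A i}
    (h : ∀ i, ∃ (f : B →ₗ[R] A i) (s : R), s ≠ 0 ∧ f b = s • x i) :
    ∃ (f : B →ₗ[R] ∀ i, A i) (s : R), s ≠ 0 ∧ f b = s • x := by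
  classical
  choose f s hs hf using h
  refine ⟨LinearMap.pi fun i => (∏ j ∈ Finset.univ.erase i, s j) • f i, ∏ i, s i,
    Finset.prod_ne_zero_iff.mpr fun i _ => hs i, funext fun i => ?_⟩
  rw [LinearMap.pi_apply, LinearMap.smul_apply, hf, smul_smul,
    Finset.prod_erase_mul _ _ (Finset.mem_univ i), Pi.smul_apply]

theorem exists_linearMap_apply_eq_smul_of_injective {R A B : Type*} [CommRing R] [IsDomain R]
    [AddCommGroup A] [Module R A] [Module.IsTorsionFree R A] [AddCommGroup B] [Module R B]
    {a : A} (f : B →ₗ[R] pureGen R a) (hf : Function.Injective f) {b : B} (hb : b ≠ 0) :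
    ∃ (g : B →ₗ[R] A) (s : R), s ≠ 0 ∧ g b = s • a := by
  obtain ⟨r, hr, s, hrs⟩ := (f b).2
  refine ⟨r • (pureGen R a).subtype ∘ₗ f, s, ?_, hrs⟩
  rintro rfl
  rw [zero_smul, smul_eq_zero, or_iff_right hr, ZeroMemClass.coe_eq_zero] at hrs
  exact hb ((map_eq_zero_iff f hf).mp hrs)

/-- Let `A` be a finite rank torsion-free module over a Dedekind
domain `R` having a rank-1 direct summand `B` with `type(B) = IT(A)` (encoded:
`B` embeds into `⟨a⟩_*` for every nonzero `a`; the converse inequality is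
automatic for a summand).  Then `A^n` is a self-pure-generator for every
positive integer `n`. -/
theorem stmt7 (R : Type*) [CommRing R] [IsDomain R] [IsDedekindDomain R]
    (A : Type u) [AddCommGroup A] [Module R A] [NoZeroSMulDivisors R A]
    (hfin : Module.rank R A < Cardinal.aleph0)
    (B C : Submodule R A) (hcompl : IsCompl B C) (hrkB : Module.rank R B = 1)
    (hemb : ∀ a : A, a ≠ 0 → ∃ f : B →ₗ[R] (pureGen R a), Function.Injective f) :
    ∀ n : ℕ, 0 < n → SelfPureGenerator R (Fin n → A) := by
  intro n hn K hK
  have : Module.IsTorsionFree R A := inferInstance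
  have : Nontrivial B := (rank_pos_iff_nontrivial (R := R)).mp (hrkB ▸ one_pos)
  obtain ⟨b₀, hb₀⟩ := exists_ne (0 : B)
  let π : (Fin n → A) →ₗ[R] B :=
    B.projectionOnto C hcompl ∘ₗ LinearMap.proj ⟨0, hn⟩
  have hπ : Function.Surjective π := fun b =>
    ⟨fun _ => b, Submodule.projectionOnto_apply_left hcompl b⟩
  have key : ∀ x : K, ∃ (f g : (Fin n → A) →ₗ[R] K) (a b : Fin n → A), f a + g b = x := by
    intro x
    obtain ⟨f, s, hs, hf⟩ := exists_linearMap_pi_apply_eq_smul (R := R) (b := b₀) (x := x.1)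
      fun i => by
        by_cases hi : x.1 i = 0
        · exact ⟨0, 1, one_ne_zero, by simp [hi]⟩
        · obtain ⟨f, hf⟩ := hemb _ hi
          exact exists_linearMap_apply_eq_smul_of_injective f hf hb₀
    have hfK : ∀ y, f y ∈ K := by
      intro y
      obtain ⟨r, hr, t, hrt⟩ := exists_smul_eq_smul_of_rank_eq_one hrkB y hb₀
      refine hK r _ hr ?_
      rw [← map_smul, hrt, map_smul, hf]
      exact K.smul_mem _ (K.smul_mem _ x.2)
    obtain ⟨h, b₁, b₂, hx⟩ := exists_linearMap_add_eq hrkB (f.codRestrict K hfK) hs (x := x)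
      ⟨b₀, Subtype.ext hf⟩
    obtain ⟨a₁, rfl⟩ := hπ b₁
    obtain ⟨a₂, rfl⟩ := hπ b₂
    exact ⟨f.codRestrict K hfK ∘ₗ π, h ∘ₗ π, a₁, a₂, hx⟩
  choose f g a b hfg using key
  refine ⟨K ⊕ K, Finsupp.lsum ℕ (Sum.elim f g), fun x =>
    ⟨Finsupp.single (.inl x) (a x) + Finsupp.single (.inr x) (b x), ?_⟩⟩
  rw [map_add, Finsupp.lsum_single, Finsupp.lsum_single]
  exact hfg x
end

section
/- Let R be a Dedekind domain and A a finite rank torsion-free R-module admitting a submodule A' = B' ⊕ C quasi-equal to A, with B' of rank 1 and type(B') ≤ IT(A). Then A has a direct summand B of rank 1 with type(B) = type(B'). -/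
open TensorProduct

open scoped nonZeroDivisors

section Domain

variable {R : Type*} [CommRing R] [IsDomain R]

/-- An element with no nonzero multiple in `C` is separated from `C` by a linear
map to the fraction field. -/
lemma exists_linearMap_fractionRing {A : Type*} [AddCommGroup A] [Module R A]
    (C : Submodule R A) (b : A) (hb : ∀ r : R, r ≠ 0 → r • b ∉ C) :
    ∃ φ : A →ₗ[R] FractionRing R, C ≤ LinearMap.ker φ ∧ φ b ≠ 0 := by
  let ι := LocalizedModule.mkLinearMap R⁰ A
  let W : Submodule (FractionRing R) (LocalizedModule R⁰ A) :=
    C.localized' (FractionRing R) R⁰ ι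
  have hbW : ι b ∉ W := by
    rintro ⟨c, hc, s, hs⟩
    rw [IsLocalizedModule.mk'_eq_iff] at hs
    have h2 : ι c = ι ((s : R) • b) := by rw [map_smul]; exact hs
    obtain ⟨t, ht⟩ := (IsLocalizedModule.eq_iff_exists R⁰ ι).1 h2
    refine hb (t * s) (mul_ne_zero (nonZeroDivisors.ne_zero t.2) (nonZeroDivisors.ne_zero s.2)) ?_
    rw [mul_smul]
    have : (t : R) • c = (t : R) • (s : R) • b := ht
    rw [← this]
    exact C.smul_mem _ hc
  obtain ⟨f, hf, hW⟩ := Submodule.exists_le_ker_of_notMem hbW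
  refine ⟨(f.restrictScalars R) ∘ₗ ι, fun c hc => ?_, hf⟩
  exact hW ⟨c, hc, 1, by simp [ι]⟩

lemma exists_ne_zero_of_rank_eq_one {B : Type*} [AddCommGroup B] [Module R B]
    [NoZeroSMulDivisors R B] (h : Module.rank R B = 1) :
    ∃ b : B, b ≠ 0 ∧ ∀ x : B, ∃ r : R, r ≠ 0 ∧ ∃ s : R, r • x = s • b := by
  have : Nontrivial B := by
    by_contra hn
    rw [not_nontrivial_iff_subsingleton] at hn
    rw [rank_subsingleton'] at h
    exact zero_ne_one h
  obtain ⟨b, hb⟩ := exists_ne (0 : B)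
  refine ⟨b, hb, fun x => ?_⟩
  have hli : ¬ LinearIndependent R ![b, x] := by
    intro hl
    have := hl.cardinal_lift_le_rank
    simp [h] at this
  rw [LinearIndependent.pair_iff] at hli
  push Not at hli
  obtain ⟨s, t, hst, hne⟩ := hli
  have ht : t ≠ 0 := by
    rintro rfl
    rcases eq_or_ne s 0 with rfl | hs
    · exact hne rfl rfl
    · simp [hs, hb] at hst
  exact ⟨t, ht, -s, by rw [neg_smul]; exact eq_neg_of_add_eq_zero_right hst⟩

/-- A linear map from a submodule of the fraction field to the fraction field is a multiplication. -/
lemma exists_forall_eq_mul {K : Type*} [Field K] [Algebra R K] [IsFractionRing R K]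
    (M : Submodule R K) (f : M →ₗ[R] K) : ∃ q : K, ∀ m : M, f m = q * m := by
  by_cases hM : ∃ m : M, m ≠ 0
  · obtain ⟨m, hm⟩ := hM
    have hm' : (m : K) ≠ 0 := by simpa using hm
    refine ⟨f m / m, fun n => ?_⟩
    obtain ⟨p, s, hs, hps⟩ := IsFractionRing.div_surjective (A := R) ((n : K) / m)
    have hs' : algebraMap R K s ≠ 0 := by
      simpa using nonZeroDivisors.ne_zero hs
    have h1 : s • n = p • m := by
      ext
      simp only [Submodule.coe_smul, Algebra.smul_def]
      field_simp at hps
      linear_combination -hps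
    have h2 := congrArg f h1
    simp only [map_smul, Algebra.smul_def] at h2
    field_simp at hps ⊢
    apply mul_left_cancel₀ hs'
    linear_combination (m : K) * h2 + f m * hps
  · push Not at hM
    exact ⟨0, fun m => by simp [hM m]⟩

end Domain

section Dedekind

variable {R : Type*} [CommRing R] [IsDedekindDomain R] {K : Type*} [Field K] [Algebra R K] [IsFractionRing R K]

variable (K) in
lemma exists_coeSubmodule_mul_eq_one {J : Ideal R} (hJ : J ≠ ⊥) :
    ∃ L : Submodule R K, IsLocalization.coeSubmodule K J * L = 1 := by
  refine ⟨((J : FractionalIdeal R⁰ K)⁻¹ : FractionalIdeal R⁰ K), ?_⟩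
  have h := mul_inv_cancel₀ (FractionalIdeal.coeIdeal_ne_zero (K := K).2 hJ)
  have := congrArg (fun F : FractionalIdeal R⁰ K => (F : Submodule R K)) h
  simpa using this

/-- Of two fractions, each divides the other locally on a cover of the spectrum. -/
lemma exists_add_eq_one_smul_eq (x y : K) :
    ∃ α β c d : R, α + β = 1 ∧ α • x = c • y ∧ β • y = d • x := by
  by_cases hxy : x = 0
  · exact ⟨1, 0, 0, 0, by simp, by simp [hxy], by simp⟩
  let L : Submodule R K := Submodule.span R {x, y}
  have hL : L.FG := Submodule.fg_span (Set.toFinite _)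
  let F : FractionalIdeal R⁰ K := ⟨L, FractionalIdeal.isFractional_of_fg hL⟩
  have hF : F ≠ 0 := by
    intro h
    have hx : x ∈ F := Submodule.subset_span (by simp)
    rw [h] at hx
    exact hxy ((FractionalIdeal.mem_zero_iff _).1 hx)
  have h1 : (1 : K) ∈ F * F⁻¹ := by
    rw [mul_inv_cancel₀ hF]; exact FractionalIdeal.one_mem_one _
  have hinv : ∀ u ∈ F⁻¹, ∀ z ∈ L, ∃ r : R, algebraMap R K r = u * z := by
    intro u hu z hz
    have : u * z ∈ F⁻¹ * F := FractionalIdeal.mul_mem_mul hu hz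
    rw [inv_mul_cancel₀ hF] at this
    exact (FractionalIdeal.mem_one_iff _).1 this
  have key : ∃ u ∈ F⁻¹, ∃ v ∈ F⁻¹, (1 : K) = u * y + v * x := by
    refine FractionalIdeal.mul_induction_on
      (C := fun k => ∃ u ∈ F⁻¹, ∃ v ∈ F⁻¹, k = u * y + v * x) h1 ?_ ?_
    · intro i hi j hj
      obtain ⟨a, b, rfl⟩ := Submodule.mem_span_pair.1 (show i ∈ L from hi)
      exact ⟨b • j, Submodule.smul_mem _ _ hj, a • j, Submodule.smul_mem _ _ hj, by
        simp only [Algebra.smul_def]; ring⟩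
    · rintro _ _ ⟨u, hu, v, hv, rfl⟩ ⟨u', hu', v', hv', rfl⟩
      exact ⟨u + u', Submodule.add_mem _ hu hu', v + v', Submodule.add_mem _ hv hv', by ring⟩
  obtain ⟨u, hu, v, hv, huv⟩ := key
  have hx : x ∈ L := Submodule.subset_span (by simp)
  have hy : y ∈ L := Submodule.subset_span (by simp)
  obtain ⟨α, hα⟩ := hinv u hu y hy
  obtain ⟨c, hc⟩ := hinv u hu x hx
  obtain ⟨β, hβ⟩ := hinv v hv x hx
  obtain ⟨d, hd⟩ := hinv v hv y hy
  refine ⟨α, β, c, d, ?_, ?_, ?_⟩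
  · apply IsFractionRing.injective R K
    rw [map_add, hα, hβ, map_one, huv]
  · rw [Algebra.smul_def, Algebra.smul_def, hα, hc]; ring
  · rw [Algebra.smul_def, Algebra.smul_def, hβ, hd]; ring

lemma Submodule.le_div_mul_of_le {M X : Submodule R K} (hMX : M ≤ X) (hM : M ≠ ⊥) :
    X ≤ X / M * M := by
  intro x hx
  let J : Ideal R := M.comap (LinearMap.toSpanSingleton R K x)
  have hJ : J ≠ ⊥ := by
    obtain ⟨m, hm, hm0⟩ := M.ne_bot_iff.1 hM
    obtain ⟨p, s, hs, hps⟩ := IsFractionRing.div_surjective (A := R) (x / m)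
    have hs' : algebraMap R K s ≠ 0 := by simpa using nonZeroDivisors.ne_zero hs
    refine (Submodule.ne_bot_iff _).2 ⟨s, ?_, nonZeroDivisors.ne_zero hs⟩
    have : s • x = p • m := by
      simp only [Algebra.smul_def]
      field_simp at hps
      linear_combination -hps
    change s • x ∈ M
    rw [this]
    exact M.smul_mem _ hm
  obtain ⟨L, hL⟩ := exists_coeSubmodule_mul_eq_one K hJ
  have hJx : IsLocalization.coeSubmodule K J * (R ∙ x) ≤ M := by
    rw [Submodule.mul_le]
    rintro _ ⟨j, hj, rfl⟩ n hn
    obtain ⟨c, rfl⟩ := Submodule.mem_span_singleton.1 hn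
    have : Algebra.linearMap R K j * c • x = c • j • x := by
      simp only [Algebra.linearMap_apply, Algebra.smul_def]; ring
    rw [this]
    exact M.smul_mem _ hj
  have hM' : M ≤ IsLocalization.coeSubmodule K J * (M ⊔ R ∙ x) := by
    intro m hm
    obtain ⟨α, β, c, d, hαβ, hα, hβ⟩ := exists_add_eq_one_smul_eq (R := R) x m
    have hm' : m = algebraMap R K α * m + algebraMap R K d * x := by
      rw [← Algebra.smul_def, ← Algebra.smul_def, ← hβ, ← add_smul, hαβ, one_smul]
    rw [hm']
    refine Submodule.add_mem _ (Submodule.mul_mem_mul ⟨α, ?_, rfl⟩ (Submodule.mem_sup_left hm))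
      (Submodule.mul_mem_mul ⟨d, ?_, rfl⟩
        (Submodule.mem_sup_right (Submodule.mem_span_singleton_self x)))
    · change α • x ∈ M
      rw [hα]; exact M.smul_mem _ hm
    · change d • x ∈ M
      rw [← hβ]; exact M.smul_mem _ hm
  have hLX : L ≤ X / M := by
    rw [Submodule.le_div_iff_mul_le]
    calc L * M ≤ L * (IsLocalization.coeSubmodule K J * (M ⊔ R ∙ x)) := by gcongr
      _ = M ⊔ R ∙ x := by rw [← mul_assoc, mul_comm L, hL, one_mul]
      _ ≤ X := sup_le hMX ((Submodule.span_singleton_le_iff_mem _ _).2 hx)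
  have : R ∙ x ≤ X / M * M := by
    calc R ∙ x = L * (IsLocalization.coeSubmodule K J * (R ∙ x)) := by
          rw [← mul_assoc, mul_comm L, hL, one_mul]
      _ ≤ X / M * M := by gcongr
  exact this (Submodule.mem_span_singleton_self x)

/-- An ideal `I` of the multiplier ring `M / M` with `I * M = M` contains `1`. -/
lemma Submodule.one_mem_of_le_mul {M I : Submodule R K} (hM : M ≠ ⊥) (hI : I ≤ M / M)
    (hEI : M / M * I ≤ I) (hIM : M ≤ I * M) : (1 : K) ∈ I := by
  let J : Ideal R := I.comap (Algebra.linearMap R K)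
  have hJI : IsLocalization.coeSubmodule K J ≤ I := Submodule.map_comap_le _ _
  have hJM : M ≤ IsLocalization.coeSubmodule K J * M := by
    refine hIM.trans (Submodule.mul_le.2 fun q hq m hm => ?_)
    obtain ⟨α, β, c, d, hαβ, hα, hβ⟩ := exists_add_eq_one_smul_eq (R := R) q 1
    have hqm : q * m = algebraMap R K c * m + algebraMap R K β * (q * m) := by
      simp only [Algebra.smul_def, mul_one] at hα
      rw [← hα]
      have : algebraMap R K α + algebraMap R K β = 1 := by rw [← map_add, hαβ, map_one]
      linear_combination (-q * m) * this
    rw [hqm]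
    refine Submodule.add_mem _ (Submodule.mul_mem_mul ⟨c, ?_, rfl⟩ hm)
      (Submodule.mul_mem_mul ⟨β, ?_, rfl⟩ (Submodule.mem_div_iff_forall_mul_mem.1 (hI hq) m hm))
    · change algebraMap R K c ∈ I
      rw [Algebra.algebraMap_eq_smul_one, ← hα]; exact I.smul_mem _ hq
    · change algebraMap R K β ∈ I
      rw [Algebra.algebraMap_eq_smul_one, hβ]; exact I.smul_mem _ hq
  have hJ : J ≠ ⊥ := by
    intro h
    rw [h, IsLocalization.coeSubmodule_bot, Submodule.bot_mul, le_bot_iff] at hJM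
    exact hM hJM
  obtain ⟨L, hL⟩ := exists_coeSubmodule_mul_eq_one K hJ
  have hLE : L ≤ M / M := by
    rw [Submodule.le_div_iff_mul_le]
    calc L * M ≤ L * (IsLocalization.coeSubmodule K J * M) := by gcongr
      _ = M := by rw [← mul_assoc, mul_comm L, hL, one_mul]
  have h1 : (1 : Submodule R K) ≤ I := by
    calc (1 : Submodule R K) = L * IsLocalization.coeSubmodule K J := by rw [mul_comm, hL]
      _ ≤ M / M * I := by gcongr
      _ ≤ I := hEI
  exact Submodule.one_le.1 h1

/-- If the range `M` of `φ : A → K` embeds into the pure closure of every nonzero element of `A`,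
then `φ` splits over `M`. -/
lemma exists_section_of_embeds_pureGen {A : Type*} [AddCommGroup A] [Module R A]
    [NoZeroSMulDivisors R A] (φ : A →ₗ[R] FractionRing R) (hφ : LinearMap.range φ ≠ ⊥)
    (h : ∀ a : A, a ≠ 0 → ∃ f : LinearMap.range φ →ₗ[R] pureGen R a, Function.Injective f) :
    ∃ f : LinearMap.range φ →ₗ[R] A, ∀ m, φ (f m) = m := by
  set M := LinearMap.range φ with hMdef
  let I : Submodule R (FractionRing R) :=
    { carrier := {q | ∃ f : M →ₗ[R] A, ∀ m : M, φ (f m) = q * m}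
      zero_mem' := ⟨0, by simp⟩
      add_mem' := by
        rintro p q ⟨f, hf⟩ ⟨g, hg⟩
        exact ⟨f + g, fun m => by simp [hf, hg, add_mul]⟩
      smul_mem' := by
        rintro c q ⟨f, hf⟩
        exact ⟨c • f, fun m => by simp [hf]⟩ }
  have hI : I ≤ M / M := by
    rintro q ⟨f, hf⟩
    refine Submodule.mem_div_iff_forall_mul_mem.2 fun m hm => ?_
    exact ⟨f ⟨m, hm⟩, hf ⟨m, hm⟩⟩
  have hEI : M / M * I ≤ I := by
    refine Submodule.mul_le.2 ?_
    rintro e he q ⟨f, hf⟩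
    let μ : M →ₗ[R] M := (LinearMap.mulLeft R e).restrict
      (Submodule.mem_div_iff_forall_mul_mem.1 he)
    refine ⟨f ∘ₗ μ, fun m => ?_⟩
    have : ((μ m : M) : FractionRing R) = e * m := rfl
    rw [LinearMap.comp_apply, hf, this]; ring
  have hIM : M ≤ I * M := by
    rintro _ ⟨a, rfl⟩
    rcases eq_or_ne a 0 with rfl | ha
    · simp
    obtain ⟨f, hf⟩ := h a ha
    obtain ⟨g, -, hga⟩ := exists_linearMap_fractionRing (⊥ : Submodule R A) a
      (fun r hr => by simp [hr, ha])
    let γ : pureGen R a →ₗ[R] FractionRing R := g ∘ₗ (pureGen R a).subtype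
    have hγ : Function.Injective γ := by
      rw [injective_iff_map_eq_zero]
      rintro ⟨x, r, hr, s, hx⟩ h0
      have h0' : g x = 0 := h0
      have h1 : s • g a = 0 := by rw [← map_smul, ← hx, map_smul, h0', smul_zero]
      have hs : s = 0 := (smul_eq_zero.1 h1).resolve_right hga
      rw [hs, zero_smul] at hx
      exact Subtype.ext ((smul_eq_zero.1 hx).resolve_left hr)
    let e := LinearEquiv.ofInjective γ hγ
    have hle : LinearMap.range (γ ∘ₗ f) ≤ LinearMap.range γ := LinearMap.range_comp_le_range _ _
    have hne : LinearMap.range (γ ∘ₗ f) ≠ ⊥ := by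
      intro h0
      obtain ⟨m, hm, hm0⟩ := M.ne_bot_iff.1 hφ
      have : γ (f ⟨m, hm⟩) = 0 := by
        rw [LinearMap.range_eq_bot] at h0
        exact LinearMap.congr_fun h0 _
      have := hf ((hγ (this.trans (map_zero γ).symm)).trans (map_zero f).symm)
      exact hm0 (congrArg Subtype.val this)
    have ha_mem : γ ⟨a, 1, one_ne_zero, 1, rfl⟩ ∈ LinearMap.range γ := ⟨_, rfl⟩
    have hgen := Submodule.le_div_mul_of_le hle hne ha_mem
    have : ∃ z : pureGen R a, γ z = γ ⟨a, 1, one_ne_zero, 1, rfl⟩ ∧ φ z ∈ I * M := by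
      refine Submodule.mul_induction_on
        (C := fun y => ∃ z : pureGen R a, γ z = y ∧ φ z ∈ I * M) hgen ?_ ?_
      · rintro q hq _ ⟨m, rfl⟩
        have hq' : ∀ n : M, q * γ (f n) ∈ LinearMap.range γ := fun n =>
          Submodule.mem_div_iff_forall_mul_mem.1 hq _ ⟨n, rfl⟩
        let k : M →ₗ[R] pureGen R a := e.symm.toLinearMap ∘ₗ
          (LinearMap.mulLeft R q ∘ₗ γ ∘ₗ f).codRestrict _ hq'
        have hk : ∀ n, γ (k n) = q * γ (f n) := fun n =>
          congrArg Subtype.val (e.apply_symm_apply ⟨q * γ (f n), hq' n⟩)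
        obtain ⟨p, hp⟩ := exists_forall_eq_mul M (φ ∘ₗ (pureGen R a).subtype ∘ₗ k)
        refine ⟨k m, hk m, ?_⟩
        have : φ (k m) = p * m := hp m
        rw [this]
        exact Submodule.mul_mem_mul ⟨(pureGen R a).subtype ∘ₗ k, hp⟩ m.2
      · rintro _ _ ⟨z, rfl, hz⟩ ⟨w, rfl, hw⟩
        exact ⟨z + w, map_add _ _ _, by
          rw [Submodule.coe_add, map_add]; exact Submodule.add_mem _ hz hw⟩
    obtain ⟨z, hz, hzI⟩ := this
    rw [hγ hz] at hzI
    exact hzI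
  obtain ⟨f, hf⟩ := Submodule.one_mem_of_le_mul hφ hI hEI hIM
  exact ⟨f, fun m => by rw [hf, one_mul]⟩

end Dedekind

/-- Let `R` be a Dedekind domain and `A` a finite rank
torsion-free `R`-module admitting a submodule `A' = B' ⊕ C` quasi-equal to `A`,
with `B'` of rank `1` and `type(B') ≤ IT(A)` (encoded: `B'` embeds into `⟨a⟩_*`
for every nonzero `a`).  Then `A` has a direct summand `B` of rank `1` with
`type(B) = type(B')` (encoded: mutual embeddings between `B` and `B'`). -/
theorem stmt18 (R : Type*) [CommRing R] [IsDomain R] [IsDedekindDomain R]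
    (A : Type*) [AddCommGroup A] [Module R A] [NoZeroSMulDivisors R A]
    (hfin : Module.rank R A < Cardinal.aleph0)
    (B' C : Submodule R A) (hind : B' ⊓ C = ⊥)
    (hqe : ∃ r : R, r ≠ 0 ∧ ∀ a : A, r • a ∈ B' ⊔ C)
    (hrkB' : Module.rank R B' = 1)
    (htype : ∀ a : A, a ≠ 0 → ∃ f : B' →ₗ[R] (pureGen R a), Function.Injective f) :
    ∃ B D : Submodule R A, IsCompl B D ∧ Module.rank R B = 1 ∧
      (∃ f : B' →ₗ[R] B, Function.Injective f) ∧
      (∃ f : B →ₗ[R] B', Function.Injective f) := by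
  obtain ⟨r, hr, hqe⟩ := hqe
  have : NoZeroSMulDivisors R B' := ⟨fun {c x} h => by
    simpa using smul_eq_zero.1 (congrArg Subtype.val h)⟩
  obtain ⟨b, hb, hb1⟩ := exists_ne_zero_of_rank_eq_one hrkB'
  have hbC : ∀ s : R, s ≠ 0 → s • (b : A) ∉ C := by
    intro s hs hC
    have h0 : s • (b : A) ∈ B' ⊓ C := ⟨B'.smul_mem _ b.2, hC⟩
    rw [hind, Submodule.mem_bot] at h0
    exact hb (Subtype.ext ((smul_eq_zero.1 h0).resolve_left hs))
  obtain ⟨φ, hCφ, hφb⟩ := exists_linearMap_fractionRing C (b : A) hbC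
  let M := LinearMap.range φ
  let ψ : B' →ₗ[R] FractionRing R := φ ∘ₗ B'.subtype
  have hψ : Function.Injective ψ := by
    rw [injective_iff_map_eq_zero]
    intro x hx
    obtain ⟨t, ht, s, hts⟩ := hb1 x
    have h1 : s • φ b = 0 := by
      have := congrArg ψ hts
      rw [map_smul, map_smul, hx, smul_zero] at this
      exact this.symm
    have hs : s = 0 := (smul_eq_zero.1 h1).resolve_right hφb
    rw [hs, zero_smul] at hts
    exact (smul_eq_zero.1 hts).resolve_left ht
  have hrM : ∀ m : M, r • (m : FractionRing R) ∈ LinearMap.range ψ := by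
    rintro ⟨_, a, rfl⟩
    obtain ⟨x, hx, c, hc, hxc⟩ := Submodule.mem_sup.1 (hqe a)
    refine ⟨⟨x, hx⟩, ?_⟩
    have hc0 : φ c = 0 := hCφ hc
    change φ x = r • φ a
    rw [← map_smul, ← hxc, map_add, hc0, add_zero]
  let i : M →ₗ[R] B' := (LinearEquiv.ofInjective ψ hψ).symm.toLinearMap ∘ₗ
    (r • M.subtype).codRestrict _ hrM
  have hi : Function.Injective i := by
    refine (LinearEquiv.ofInjective ψ hψ).symm.injective.comp ?_
    intro m n hmn
    have h1 : r • (m : FractionRing R) = r • (n : FractionRing R) := congrArg Subtype.val hmn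
    exact Subtype.ext (smul_right_injective _ hr h1)
  let j : B' →ₗ[R] M := ψ.codRestrict M fun x => ⟨x, rfl⟩
  have hj : Function.Injective j := fun x y hxy => hψ (congrArg Subtype.val hxy)
  have hM : M ≠ ⊥ := (Submodule.ne_bot_iff _).2 ⟨φ b, ⟨b, rfl⟩, hφb⟩
  obtain ⟨f, hf⟩ := exists_section_of_embeds_pureGen φ hM fun a ha => by
    obtain ⟨g, hg⟩ := htype a ha
    exact ⟨g ∘ₗ i, hg.comp hi⟩
  have hfinj : Function.Injective f := fun m n hmn => by
    apply Subtype.ext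
    rw [← hf m, ← hf n, hmn]
  let e := LinearEquiv.ofInjective f hfinj
  have hj' : Function.Injective (e.toLinearMap ∘ₗ j) := e.injective.comp hj
  have hi' : Function.Injective (i ∘ₗ e.symm.toLinearMap) := hi.comp e.symm.injective
  refine ⟨LinearMap.range f, LinearMap.ker φ, ?_, ?_, ⟨_, hj'⟩, ⟨_, hi'⟩⟩
  · rw [isCompl_iff, Submodule.disjoint_def, codisjoint_iff, eq_top_iff]
    refine ⟨?_, fun a _ => ?_⟩
    · rintro _ ⟨m, rfl⟩ hm
      have h0 : (m : FractionRing R) = 0 := by rw [← hf m]; exact hm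
      rw [show m = 0 from Subtype.ext h0, map_zero]
    · refine Submodule.mem_sup.2 ⟨f ⟨φ a, a, rfl⟩, ⟨_, rfl⟩, a - f ⟨φ a, a, rfl⟩, ?_, by abel⟩
      rw [LinearMap.mem_ker, map_sub, hf, sub_self]
  · rw [← hrkB']
    exact le_antisymm (LinearMap.rank_le_of_injective _ hi') (LinearMap.rank_le_of_injective _ hj')
end
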